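/- Let n ≥ 2, let ξ ∈ ℝⁿ be Diophantine with constants C_ξ, σ > 0 such that |ξ·k| ≥ C_ξ |k|^{−(n+σ)} for all k ∈ ℤⁿ\{0}, and let G ∈ C^m(ℝⁿ) be ℤⁿ-periodic with m > 2n + σ and G > 0 everywhere. Let v(τ;c) solve v̇ = ξ/G(v), v(0) = c, and u^ε(t;c) = ε v(t/ε; c/ε) solve u̇^ε = ξ/G(u^ε/ε), u^ε(0) = c. Then: (i) condition (f5) holds for this flow, i.e., there is C₀ > 0 such that v_i(τ;c²) − v_i(τ;c¹) ≤ C₀ for all i, all τ > 0 and all c¹, c² with c¹ − c² ∈ [0,1]ⁿ; and (ii) there exist a constant C > 0 and a vector f̄ ∈ ℝⁿ, depending only on G and ξ, such that for all t > 0, all ε > 0, all c ∈ ℝⁿ and each i, |u^ε_i(t;c) − (c_i + f̄_i t)| ≤ C ε. -/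

import Mathlib

open MeasureTheory UnitAddTorus

theorem exists_continuousMap_unitAddTorus {n : ℕ} {G : (Fin n → ℝ) → ℝ} (hG : Continuous G)
    (hper : ∀ (x : Fin n → ℝ) (l : Fin n → ℤ), G (x + fun i => (l i : ℝ)) = G x) :
    ∃ g : C(UnitAddTorus (Fin n), ℝ),
      ∀ x : Fin n → ℝ, g (fun i => (x i : UnitAddCircle)) = G x := by
  have hq : IsOpenQuotientMap
      (Pi.map fun (_ : Fin n) (t : ℝ) => (t : UnitAddCircle)) :=
    IsOpenQuotientMap.piMap fun _ => QuotientAddGroup.isOpenQuotientMap_mk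
  have hlift : ∀ x : Fin n → ℝ, G (fun i => Quotient.out (x i : UnitAddCircle)) = G x := by
    intro x
    have h : ∀ i, ∃ l : ℤ, Quotient.out (x i : UnitAddCircle) = x i + l := by
      intro i
      have h1 : ((Quotient.out (x i : UnitAddCircle) : ℝ) : UnitAddCircle)
          = (x i : UnitAddCircle) := Quotient.out_eq _
      rw [← sub_eq_zero, ← AddCircle.coe_sub, AddCircle.coe_eq_zero_iff] at h1
      obtain ⟨l, hl⟩ := h1
      exact ⟨l, by rw [zsmul_one] at hl; linarith⟩
    choose l hl using h
    rw [← hper x l]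
    congr 1
    funext i
    exact hl i
  refine ⟨⟨fun y => G fun i => Quotient.out (y i), ?_⟩, hlift⟩
  rw [← hq.continuous_comp_iff]
  convert hG using 1
  funext x
  exact hlift x

theorem hasLineDerivAt_fwdDiff_iter {E : Type*} [AddCommGroup E] [Module ℝ E] (e h : E) (m : ℕ) :
    ∀ {F F' : E → ℝ}, (∀ x, HasLineDerivAt ℝ F (F' x) x e) →
      ∀ x, HasLineDerivAt ℝ ((fwdDiff h)^[m] F) ((fwdDiff h)^[m] F' x) x e := by
  induction m with
  | zero => exact fun hF x => hF x
  | succ m ih =>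
    intro F F' hF
    refine ih fun x => ?_
    have h1 := (hF (x + h)).sub (hF x)
    simp only [HasLineDerivAt, fwdDiff] at h1 ⊢
    convert h1 using 1
    funext t
    simp [add_right_comm]

theorem exists_abs_fwdDiff_iter_le {n : ℕ} (e : Fin n → ℝ) (m : ℕ) :
    ∀ {G : (Fin n → ℝ) → ℝ}, ContDiff ℝ m G →
      (∀ (x : Fin n → ℝ) (l : Fin n → ℤ), G (x + fun i => (l i : ℝ)) = G x) →
      ∃ C : ℝ, 0 ≤ C ∧ ∀ (t : ℝ) (x : Fin n → ℝ), |(fwdDiff (t • e))^[m] G x| ≤ C * |t| ^ m := by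
  induction m with
  | zero =>
    intro G hG hper
    obtain ⟨g, hg⟩ := exists_continuousMap_unitAddTorus hG.continuous hper
    refine ⟨‖g‖, norm_nonneg _, fun t x => ?_⟩
    simpa [← hg x] using g.norm_coe_le_norm _
  | succ m ih =>
    intro G hG hper
    have hd : Differentiable ℝ G := hG.differentiable (by simp)
    have hG' : ContDiff ℝ m fun x => fderiv ℝ G x e :=
      (hG.fderiv_right (by norm_cast)).clm_apply contDiff_const
    obtain ⟨C, hC, hb⟩ := ih hG' fun x l => by
      rw [← fderiv_comp_add_right, funext fun y => hper y l]
    refine ⟨C, hC, fun t x => ?_⟩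
    have hline := hasLineDerivAt_fwdDiff_iter e (t • e) m
      fun y => (hd y).hasFDerivAt.hasLineDerivAt e
    have hder : ∀ s ∈ (Set.univ : Set ℝ), HasDerivWithinAt
        (fun s : ℝ => (fwdDiff (t • e))^[m] G (x + s • e))
        ((fwdDiff (t • e))^[m] (fun y => fderiv ℝ G y e) (x + s • e)) Set.univ s := by
      intro s _
      have h := hline (x + s • e)
      rw [HasLineDerivAt] at h
      have h2 := HasDerivAt.comp_sub_const s s
        (f := fun r : ℝ => (fwdDiff (t • e))^[m] G (x + s • e + r • e)) (by simpa using h)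
      refine HasDerivAt.hasDerivWithinAt ?_
      convert h2 using 1
      funext r
      rw [sub_smul, add_assoc, add_sub_cancel]
    have := Convex.norm_image_sub_le_of_norm_hasDerivWithin_le hder (fun s _ => hb t _)
      convex_univ (Set.mem_univ 0) (Set.mem_univ t)
    rw [Function.iterate_succ_apply', fwdDiff, pow_succ, ← mul_assoc]
    simpa using this

/-- The Haar probability measure on the unit torus. -/
noncomputable abbrev torusHaar (n : ℕ) : Measure (UnitAddTorus (Fin n)) :=
  Measure.pi fun _ => AddCircle.haarAddCircle

theorem mFourierCoeff_eq_integral_torusHaar {n : ℕ} (f : UnitAddTorus (Fin n) → ℂ)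
    (k : Fin n → ℤ) : mFourierCoeff f k = ∫ x, mFourier (-k) x • f x ∂torusHaar n :=
  rfl

theorem mFourierCoeff_fwdDiff_iter {n : ℕ} (a : UnitAddTorus (Fin n)) (k : Fin n → ℤ) (m : ℕ) :
    ∀ {g : UnitAddTorus (Fin n) → ℂ}, Continuous g →
      mFourierCoeff ((fwdDiff a)^[m] g) k = (mFourier k a - 1) ^ m * mFourierCoeff g k := by
  induction m with
  | zero => simp
  | succ m ih =>
    intro g hg
    have hshift : Continuous fun x => g (x + a) := by fun_prop
    rw [Function.iterate_succ_apply, ih (show Continuous (fwdDiff a g) from hshift.sub hg), pow_succ,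
      mul_assoc]
    congr 1
    have hint : ∀ f : UnitAddTorus (Fin n) → ℂ, Continuous f →
        Integrable (fun x => mFourier (-k) x • f x) (torusHaar n) := fun f hf =>
      Continuous.integrable_of_hasCompactSupport (by fun_prop) (HasCompactSupport.of_compactSpace _)
    have hmul : ∀ x, mFourier (-k) x • g (x + a)
        = mFourier k a * (mFourier (-k) (x + a) • g (x + a)) := by
      intro x
      have h1 : mFourier (-k) (x + a) = mFourier (-k) x * mFourier (-k) a := by
        simp [mFourier, AddCircle.toCircle_add, Finset.prod_mul_distrib]
      have h2 : mFourier k a * mFourier (-k) a = 1 := by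
        rw [← mFourier_add]; simp [mFourier_zero]
      rw [h1, smul_eq_mul, smul_eq_mul]
      linear_combination (- mFourier (-k) x * g (x + a)) * h2
    calc mFourierCoeff (fwdDiff a g) k
        = (∫ x, mFourier (-k) x • g (x + a) ∂torusHaar n)
            - ∫ x, mFourier (-k) x • g x ∂torusHaar n := by
          rw [← integral_sub (hint _ hshift) (hint _ hg)]
          simp only [mFourierCoeff_eq_integral_torusHaar, fwdDiff, smul_sub]
      _ = _ := by
          simp_rw [hmul]
          rw [integral_const_mul, integral_add_right_eq_self (fun x => mFourier (-k) x • g x)]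
          rw [mFourierCoeff_eq_integral_torusHaar]
          ring

theorem summable_norm_intCast_rpow {n : ℕ} {r : ℝ} (hr : r < -(n : ℝ)) :
    Summable fun k : Fin n → ℤ => ‖(fun i => (k i : ℝ) : Fin n → ℝ)‖ ^ r := by
  let L := Submodule.span ℤ (Set.range (Pi.basisFun ℝ (Fin n)))
  have hrank : Module.finrank ℤ L = n := by
    rw [ZLattice.rank ℝ L]; simp
  have hmem : ∀ k : Fin n → ℤ, (fun i => (k i : ℝ)) ∈ L := fun k => by
    rw [Module.Basis.mem_span_iff_repr_mem]
    intro i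
    simp
  have hs := ZLattice.summable_norm_rpow L r (by rw [hrank]; exact hr)
  refine (hs.comp_injective (i := fun k : Fin n → ℤ => (⟨_, hmem k⟩ : L)) ?_)
  intro k l hkl
  funext i
  simpa using congrFun (congrArg Subtype.val hkl) i

theorem mFourier_coe {n : ℕ} (k : Fin n → ℤ) (x : Fin n → ℝ) :
    mFourier k (fun i => (x i : UnitAddCircle))
      = Complex.exp (2 * Real.pi * Complex.I * ((∑ i, x i * k i : ℝ) : ℂ)) := by
  simp only [mFourier, ContinuousMap.coe_mk, fourier_coe_apply, ← Complex.exp_sum]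
  congr 1
  push_cast
  rw [Finset.mul_sum]
  refine Finset.sum_congr rfl fun i _ => ?_
  simp
  ring

theorem norm_integral_mFourier_line_le {n : ℕ} (k : Fin n → ℤ) (ξ c : Fin n → ℝ)
    (hk : ∑ i, ξ i * k i ≠ 0) (s : ℝ) :
    ‖∫ r in (0 : ℝ)..s, mFourier k (fun i => ((c i + r * ξ i : ℝ) : UnitAddCircle))‖
      ≤ |∑ i, ξ i * k i|⁻¹ := by
  set ω := ∑ i, ξ i * k i with hω
  have hfun : ∀ r : ℝ, mFourier k (fun i => ((c i + r * ξ i : ℝ) : UnitAddCircle))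
      = Complex.exp ((2 * Real.pi * ∑ i, c i * k i : ℝ) * Complex.I) *
        Complex.exp ((2 * Real.pi * ω : ℝ) * Complex.I * r) := by
    intro r
    rw [mFourier_coe k (fun i => c i + r * ξ i), ← Complex.exp_add]
    congr 1
    have : ∑ i, (c i + r * ξ i) * k i = ∑ i, c i * k i + r * ω := by
      rw [hω, Finset.mul_sum, ← Finset.sum_add_distrib]
      exact Finset.sum_congr rfl fun i _ => by ring
    rw [this]
    push_cast
    ring
  have h2π : (2 * Real.pi * ω : ℝ) ≠ 0 := by positivity
  have hne : ((2 * Real.pi * ω : ℝ) : ℂ) * Complex.I ≠ 0 :=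
    mul_ne_zero (by exact_mod_cast h2π) Complex.I_ne_zero
  simp_rw [hfun]
  rw [intervalIntegral.integral_const_mul, integral_exp_mul_complex hne, norm_mul,
    Complex.norm_exp_ofReal_mul_I, one_mul, norm_div]
  have hnum : ‖Complex.exp ((2 * Real.pi * ω : ℝ) * Complex.I * s) -
      Complex.exp ((2 * Real.pi * ω : ℝ) * Complex.I * (0 : ℝ))‖ ≤ 2 := by
    refine (norm_sub_le _ _).trans ?_
    rw [show ((2 * Real.pi * ω : ℝ) : ℂ) * Complex.I * s
      = ((2 * Real.pi * ω * s : ℝ) : ℂ) * Complex.I by push_cast; ring,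
      Complex.norm_exp_ofReal_mul_I]
    norm_num
  have hden : ‖((2 * Real.pi * ω : ℝ) : ℂ) * Complex.I‖ = 2 * Real.pi * |ω| := by
    rw [norm_mul, Complex.norm_real, Complex.norm_I, mul_one, Real.norm_eq_abs, abs_mul,
      abs_of_pos (by positivity)]
  rw [hden]
  have hω0 : 0 < |ω| := abs_pos.mpr hk
  rw [div_le_iff₀ (by positivity)]
  refine hnum.trans ?_
  have : |ω|⁻¹ * (2 * Real.pi * |ω|) = 2 * Real.pi := by field_simp
  rw [this]
  linarith [Real.pi_gt_three]

theorem exists_add_smul_of_hasDerivAt {n : ℕ} {G : (Fin n → ℝ) → ℝ} {ξ : Fin n → ℝ}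
    (hG : Continuous G) (hpos : ∀ x, 0 < G x) {w : ℝ → Fin n → ℝ}
    (hw : ∀ τ, HasDerivAt w ((G (w τ))⁻¹ • ξ) τ) (τ : ℝ) :
    ∃ s : ℝ, w τ = w 0 + s • ξ ∧ ∫ r in (0 : ℝ)..s, G (w 0 + r • ξ) = τ := by
  have hwc : Continuous w := continuous_iff_continuousAt.mpr fun t => (hw t).continuousAt
  have hinv : Continuous fun t => (G (w t))⁻¹ :=
    (hG.comp hwc).inv₀ fun t => (hpos _).ne'
  set S : ℝ → ℝ := fun t => ∫ r in (0 : ℝ)..t, (G (w r))⁻¹ with hS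
  have hSd : ∀ t, HasDerivAt S (G (w t))⁻¹ t :=
    fun t => (hinv.integral_hasStrictDerivAt 0 t).hasDerivAt
  have hS0 : S 0 = 0 := by simp [hS]
  have hwS : ∀ t, w t = w 0 + S t • ξ := by
    intro t
    have hd : ∀ t, HasDerivAt (fun t => w t - S t • ξ) 0 t := fun t => by
      have h := (hw t).sub ((hSd t).smul_const ξ)
      rw [sub_self] at h
      exact h
    have := is_const_of_deriv_eq_zero (fun t => (hd t).differentiableAt) (fun t => (hd t).deriv) t 0
    simp only [hS0, zero_smul, sub_zero] at this
    rw [← this]; abel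
  refine ⟨S τ, hwS τ, ?_⟩
  have hline : Continuous fun r : ℝ => G (w 0 + r • ξ) := by fun_prop
  have hd : ∀ t, HasDerivAt (fun t => (∫ r in (0 : ℝ)..S t, G (w 0 + r • ξ)) - t) 0 t := fun t => by
    have h := ((hline.integral_hasStrictDerivAt 0 (S t)).hasDerivAt.comp t (hSd t)).sub
      (hasDerivAt_id t)
    rw [← hwS t, mul_inv_cancel₀ (hpos _).ne', sub_self] at h
    exact h
  have := is_const_of_deriv_eq_zero (fun t => (hd t).differentiableAt) (fun t => (hd t).deriv) τ 0
  simp only [hS0, intervalIntegral.integral_same, sub_zero] at this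
  linarith

theorem norm_mFourierCoeff_le {n : ℕ} {g : UnitAddTorus (Fin n) → ℂ} {M : ℝ}
    (hM : ∀ x, ‖g x‖ ≤ M) (k : Fin n → ℤ) : ‖mFourierCoeff g k‖ ≤ M := by
  rw [mFourierCoeff_eq_integral_torusHaar]
  refine (norm_integral_le_of_norm_le_const (C := M) (ae_of_all _ fun x => ?_)).trans (by simp)
  rw [norm_smul]
  refine (mul_le_mul_of_nonneg_right ((mFourier (-k)).norm_coe_le_norm x) (norm_nonneg _)).trans ?_
  rw [mFourier_norm, one_mul]
  exact hM x

theorem fwdDiff_iter_coe {n : ℕ} {g : UnitAddTorus (Fin n) → ℂ} {G : (Fin n → ℝ) → ℝ}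
    (h : Fin n → ℝ) (m : ℕ) (hg : ∀ x : Fin n → ℝ, g (fun i => (x i : UnitAddCircle)) = G x) :
    ∀ x : Fin n → ℝ, (fwdDiff fun i => (h i : UnitAddCircle))^[m] g
      (fun i => (x i : UnitAddCircle)) = ((fwdDiff h)^[m] G x : ℝ) := by
  induction m with
  | zero => exact hg
  | succ m ih =>
    intro x
    rw [Function.iterate_succ_apply', Function.iterate_succ_apply', fwdDiff, fwdDiff,
      Complex.ofReal_sub, ← ih x, ← ih (x + h)]
    rfl

theorem exists_norm_mFourierCoeff_le_rpow {n : ℕ} {G : (Fin n → ℝ) → ℝ} {m : ℕ}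
    (hG : ContDiff ℝ m G)
    (hper : ∀ (x : Fin n → ℝ) (l : Fin n → ℤ), G (x + fun i => (l i : ℝ)) = G x)
    {g : UnitAddTorus (Fin n) → ℂ} (hgc : Continuous g)
    (hg : ∀ x : Fin n → ℝ, g (fun i => (x i : UnitAddCircle)) = G x) :
    ∃ D : ℝ, 0 ≤ D ∧ ∀ k : Fin n → ℤ, k ≠ 0 →
      ‖mFourierCoeff g k‖ ≤ D * ‖(fun i => (k i : ℝ) : Fin n → ℝ)‖ ^ (-(m : ℝ)) := by
  choose C hC0 hC using fun i : Fin n =>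
    exists_abs_fwdDiff_iter_le (Pi.single i (1 : ℝ)) m hG hper
  refine ⟨∑ i, C i, Finset.sum_nonneg fun i _ => hC0 i, fun k hk => ?_⟩
  have : Nonempty (Fin n) := by
    obtain ⟨i, -⟩ := Function.ne_iff.mp hk
    exact ⟨i⟩
  obtain ⟨i, hi⟩ := Finite.exists_max fun i => |(k i : ℝ)|
  have hnorm : ‖(fun i => (k i : ℝ) : Fin n → ℝ)‖ = |(k i : ℝ)| :=
    le_antisymm ((pi_norm_le_iff_of_nonneg (abs_nonneg _)).mpr hi)
      (norm_le_pi_norm (fun i => (k i : ℝ)) i)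
  have hki : (k i : ℝ) ≠ 0 := by
    intro h0
    apply hk
    funext j
    have := hi j
    rw [h0, abs_zero] at this
    exact_mod_cast abs_nonpos_iff.mp this
  set t : ℝ := (2 * k i)⁻¹ with ht
  set h : Fin n → ℝ := t • Pi.single i (1 : ℝ) with hh
  have hchar : mFourier k (fun j => (h j : UnitAddCircle)) = -1 := by
    rw [mFourier_coe]
    have hsum : ∑ j, h j * k j = 1 / 2 := by
      rw [Finset.sum_eq_single i]
      · simp [hh, ht]
        field_simp
      · intro j _ hj
        simp [hh, hj]
      · simp
    rw [hsum, ← Complex.exp_pi_mul_I]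
    congr 1
    push_cast
    ring
  have hcoeff := mFourierCoeff_fwdDiff_iter (fun j => (h j : UnitAddCircle)) k m hgc
  have hbound : ‖mFourierCoeff ((fwdDiff fun j => (h j : UnitAddCircle))^[m] g) k‖
      ≤ C i * |t| ^ m := by
    refine norm_mFourierCoeff_le (fun y => ?_) k
    obtain ⟨x, rfl⟩ : ∃ x : Fin n → ℝ, (fun j => (x j : UnitAddCircle)) = y :=
      ⟨fun j => Quotient.out (y j), funext fun j => Quotient.out_eq _⟩
    rw [fwdDiff_iter_coe h m hg, Complex.norm_real]
    exact hC i t x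
  rw [hcoeff, hchar, norm_mul, norm_pow] at hbound
  have hone : (1 : ℝ) ≤ ‖(-1 - 1 : ℂ)‖ ^ m := one_le_pow₀ (by norm_num)
  have htle : |t| ≤ |(k i : ℝ)|⁻¹ := by
    rw [ht, abs_inv, abs_mul, abs_two]
    have := abs_pos.mpr hki
    gcongr
    linarith
  calc ‖mFourierCoeff g k‖ ≤ ‖(-1 - 1 : ℂ)‖ ^ m * ‖mFourierCoeff g k‖ :=
        le_mul_of_one_le_left (norm_nonneg _) hone
    _ ≤ C i * |t| ^ m := hbound
    _ ≤ (∑ i, C i) * (|(k i : ℝ)|⁻¹) ^ m := by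
        gcongr
        · exact Finset.sum_nonneg fun i _ => hC0 i
        · exact Finset.single_le_sum (fun i _ => hC0 i) (Finset.mem_univ i)
    _ = _ := by
        rw [hnorm, Real.rpow_neg (abs_nonneg _), Real.rpow_natCast, inv_pow]

theorem exists_abs_integral_line_sub_le {n : ℕ} {ξ : Fin n → ℝ} {Cξ σ : ℝ} (hCξ : 0 < Cξ)
    (hσ : 0 < σ)
    (hdio : ∀ k : Fin n → ℤ, k ≠ 0 →
      Cξ * ‖((fun i => (k i : ℝ)) : Fin n → ℝ)‖ ^ (-((n : ℝ) + σ)) ≤ |∑ i, ξ i * k i|)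
    {G : (Fin n → ℝ) → ℝ} {m : ℕ} (hm : 2 * (n : ℝ) + σ < m) (hG : ContDiff ℝ m G)
    (hper : ∀ (x : Fin n → ℝ) (l : Fin n → ℤ), G (x + fun i => (l i : ℝ)) = G x)
    (hpos : ∀ x, 0 < G x) :
    ∃ γ > (0 : ℝ), ∃ K : ℝ, 0 ≤ K ∧ ∀ (c : Fin n → ℝ) (s : ℝ),
      |(∫ r in (0 : ℝ)..s, G (c + r • ξ)) - γ * s| ≤ K := by
  obtain ⟨g, hg⟩ := exists_continuousMap_unitAddTorus hG.continuous hper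
  let gc : C(UnitAddTorus (Fin n), ℂ) := ⟨fun x => (g x : ℂ), by fun_prop⟩
  have hgc : ∀ x : Fin n → ℝ, gc (fun i => (x i : UnitAddCircle)) = G x := fun x => by
    rw [← hg x]; rfl
  obtain ⟨D, hD0, hD⟩ := exists_norm_mFourierCoeff_le_rpow hG hper gc.continuous hgc
  set γ : ℝ := ∫ x, g x ∂torusHaar n with hγ
  have hγ0 : mFourierCoeff gc 0 = γ := by
    rw [mFourierCoeff_eq_integral_torusHaar, neg_zero, mFourier_zero, hγ, ← integral_complex_ofReal]
    simp [gc]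
  have hγpos : 0 < γ := by
    have hgpos : ∀ y, 0 < g y := fun y => by
      have hy : (fun i => ((Quotient.out (y i) : ℝ) : UnitAddCircle)) = y :=
        funext fun i => Quotient.out_eq _
      rw [← hy, hg]
      exact hpos _
    rw [hγ, integral_pos_iff_support_of_nonneg (fun y => (hgpos y).le)
      (g.continuous.integrable_of_hasCompactSupport (HasCompactSupport.of_compactSpace _)),
      Set.eq_univ_of_forall (s := Function.support g) fun y => (hgpos y).ne', measure_univ]
    exact one_pos
  have hn0 : (0 : ℝ) ≤ n := Nat.cast_nonneg n
  have hcoeff : Summable (mFourierCoeff gc) := by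
    refine Summable.of_norm_bounded_eventually
      ((summable_norm_intCast_rpow (n := n) (r := -(m : ℝ)) (by linarith)).mul_left D) ?_
    filter_upwards [(Set.finite_singleton (0 : Fin n → ℤ)).compl_mem_cofinite] with k hk
    exact hD k hk
  set b : (Fin n → ℤ) → ℝ := fun k =>
    D / Cξ * ‖(fun i => (k i : ℝ) : Fin n → ℝ)‖ ^ ((n : ℝ) + σ - m) with hb
  have hbs : Summable b := (summable_norm_intCast_rpow (by linarith)).mul_left _
  have hb0 : ∀ k, 0 ≤ b k := fun k => by positivity
  refine ⟨γ, hγpos, ∑' k, b k, tsum_nonneg hb0, fun c s => ?_⟩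
  have hline : Continuous fun r : ℝ => (fun i => ((c i + r * ξ i : ℝ) : UnitAddCircle)) :=
    continuous_pi fun i => (AddCircle.continuous_mk' _).comp (by fun_prop)
  let f : (Fin n → ℤ) → C(ℝ, ℂ) := fun k =>
    ⟨fun r => mFourierCoeff gc k • mFourier k (fun i => ((c i + r * ξ i : ℝ) : UnitAddCircle)),
      by fun_prop⟩
  have hsum := intervalIntegral.hasSum_intervalIntegral_of_summable_norm (a := 0) (b := s) (f := f)
    (by
      refine Summable.of_nonneg_of_le (fun _ => norm_nonneg _) (fun k => ?_) hcoeff.norm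
      refine (ContinuousMap.norm_le _ (norm_nonneg _)).mpr fun r => ?_
      rw [ContinuousMap.restrict_apply, ContinuousMap.coe_mk, norm_smul]
      refine mul_le_of_le_one_right (norm_nonneg _) ?_
      exact ((mFourier k).norm_coe_le_norm _).trans_eq mFourier_norm)
  have hval : ∀ r : ℝ, ∑' k, f k r = (G (c + r • ξ) : ℂ) := fun r => by
    rw [← hgc (c + r • ξ)]
    exact (hasSum_mFourier_series_apply_of_summable hcoeff _).tsum_eq
  simp_rw [hval] at hsum
  rw [intervalIntegral.integral_ofReal] at hsum
  have hzero : ∫ r in (0 : ℝ)..s, f 0 r = (γ * s : ℝ) := by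
    simp [f, mFourier_zero, hγ0, mul_comm]
  have hdiff := hsum.sub (hasSum_ite_eq (0 : Fin n → ℤ) ((γ * s : ℝ) : ℂ))
  rw [← Complex.ofReal_sub] at hdiff
  rw [← Real.norm_eq_abs, ← Complex.norm_real, ← hdiff.tsum_eq]
  refine tsum_of_norm_bounded hbs.hasSum fun k => ?_
  by_cases hk : k = 0
  · subst hk
    simpa [hzero] using hb0 0
  · rw [if_neg hk, sub_zero]
    have hkpos : 0 < ‖(fun i => (k i : ℝ) : Fin n → ℝ)‖ := by
      rw [norm_pos_iff]
      intro h0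
      exact hk (funext fun i => by simpa using congrFun h0 i)
    set N := ‖(fun i => (k i : ℝ) : Fin n → ℝ)‖
    have hlow := hdio k hk
    have hlow0 : 0 < Cξ * N ^ (-((n : ℝ) + σ)) := by positivity
    have hω : ∑ i, ξ i * k i ≠ 0 := abs_pos.mp (hlow0.trans_le hlow)
    have hint := norm_integral_mFourier_line_le k ξ c hω s
    calc ‖∫ r in (0 : ℝ)..s, f k r‖
        = ‖mFourierCoeff gc k‖ * ‖∫ r in (0 : ℝ)..s,
            mFourier k (fun i => ((c i + r * ξ i : ℝ) : UnitAddCircle))‖ := by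
          rw [← norm_smul, ← intervalIntegral.integral_smul]
          rfl
      _ ≤ (D * N ^ (-(m : ℝ))) * (Cξ * N ^ (-((n : ℝ) + σ)))⁻¹ := by
          refine mul_le_mul (hD k hk) (hint.trans ?_) (norm_nonneg _) (by positivity)
          gcongr
      _ = b k := by
          have : N ^ ((n : ℝ) + σ - m) = N ^ (-(m : ℝ)) * N ^ ((n : ℝ) + σ) := by
            rw [← Real.rpow_add hkpos]; ring_nf
          simp only [hb]
          rw [this, Real.rpow_neg hkpos.le ((n : ℝ) + σ), mul_inv, inv_inv]
          ring

theorem exists_abs_sub_linear_le {n : ℕ} {ξ : Fin n → ℝ} {Cξ σ : ℝ} (hCξ : 0 < Cξ)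
    (hσ : 0 < σ)
    (hdio : ∀ k : Fin n → ℤ, k ≠ 0 →
      Cξ * ‖((fun i => (k i : ℝ)) : Fin n → ℝ)‖ ^ (-((n : ℝ) + σ)) ≤ |∑ i, ξ i * k i|)
    {G : (Fin n → ℝ) → ℝ} {m : ℕ} (hm : 2 * (n : ℝ) + σ < m) (hG : ContDiff ℝ m G)
    (hper : ∀ (x : Fin n → ℝ) (l : Fin n → ℤ), G (x + fun i => (l i : ℝ)) = G x)
    (hpos : ∀ x, 0 < G x) :
    ∃ C > (0 : ℝ), ∃ fbar : Fin n → ℝ, ∀ w : ℝ → Fin n → ℝ,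
      (∀ τ, HasDerivAt w ((G (w τ))⁻¹ • ξ) τ) →
      ∀ τ i, |w τ i - (w 0 i + fbar i * τ)| ≤ C := by
  obtain ⟨γ, hγ, K, hK, hbound⟩ := exists_abs_integral_line_sub_le hCξ hσ hdio hm hG hper hpos
  refine ⟨‖ξ‖ * (K / γ) + 1, by positivity, γ⁻¹ • ξ, fun w hw τ i => ?_⟩
  obtain ⟨s, hws, hs⟩ := exists_add_smul_of_hasDerivAt hG.continuous hpos hw τ
  have hτ := hbound (w 0) s
  rw [hs] at hτ
  have heq : w τ i - (w 0 i + (γ⁻¹ • ξ) i * τ) = -(ξ i * ((τ - γ * s) / γ)) := by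
    rw [hws]
    simp only [Pi.add_apply, Pi.smul_apply, smul_eq_mul]
    field_simp
    ring
  rw [heq, abs_neg, abs_mul, abs_div, abs_of_pos hγ]
  have : |ξ i| * (|τ - γ * s| / γ) ≤ ‖ξ‖ * (K / γ) := by
    gcongr
    exact norm_le_pi_norm ξ i
  linarith

/-- Irrational shear flows: for a Diophantine `ξ` and a positive, smooth,
`ℤⁿ`-periodic `G`, the flow of `v̇ = ξ/G(v)` satisfies condition (f5), and the
homogenization estimate `|u^ε_i(t;c) - (c_i + f̄_i t)| ≤ C ε` holds. -/
theorem stmt_7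
    (n : ℕ) (hn : 2 ≤ n)
    (ξ : Fin n → ℝ) (Cξ σ : ℝ) (hCξ : 0 < Cξ) (hσ : 0 < σ)
    (hdio : ∀ k : Fin n → ℤ, k ≠ 0 →
      Cξ * ‖((fun i => (k i : ℝ)) : Fin n → ℝ)‖ ^ (-((n : ℝ) + σ)) ≤ |∑ i, ξ i * k i|)
    (G : (Fin n → ℝ) → ℝ) (m : ℕ) (hm : 2 * (n : ℝ) + σ < m)
    (hG : ContDiff ℝ m G)
    (hGper : ∀ (x : Fin n → ℝ) (l : Fin n → ℤ), G (x + fun i => (l i : ℝ)) = G x)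
    (hGpos : ∀ x, 0 < G x)
    (v : (Fin n → ℝ) → ℝ → (Fin n → ℝ))
    (hv0 : ∀ c, v c 0 = c)
    (hv : ∀ c τ, HasDerivAt (v c) ((G (v c τ))⁻¹ • ξ) τ) :
    (∃ C₀ > (0 : ℝ), ∀ c₁ c₂ : Fin n → ℝ, c₁ - c₂ ∈ Set.Icc (0 : Fin n → ℝ) 1 →
      ∀ i, ∀ τ > (0 : ℝ), v c₂ τ i - v c₁ τ i ≤ C₀) ∧
    ∃ C > (0 : ℝ), ∃ fbar : Fin n → ℝ,
      ∀ ε > (0 : ℝ), ∀ c : Fin n → ℝ, ∀ u : ℝ → (Fin n → ℝ), u 0 = c →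
        (∀ s, HasDerivAt u ((G (ε⁻¹ • u s))⁻¹ • ξ) s) →
        ∀ t > (0 : ℝ), ∀ i, |u t i - (c i + fbar i * t)| ≤ C * ε := by
  obtain ⟨C, hC, fbar, h⟩ := exists_abs_sub_linear_le hCξ hσ hdio hm hG hGper hGpos
  refine ⟨⟨2 * C, by positivity, fun c₁ c₂ hc i τ _ => ?_⟩, C, hC, fbar, ?_⟩
  · have h₁ := abs_le.mp (h (v c₁) (hv c₁) τ i)
    have h₂ := abs_le.mp (h (v c₂) (hv c₂) τ i)
    rw [hv0] at h₁ h₂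
    have hci := hc.1 i
    simp only [Pi.zero_apply, Pi.sub_apply] at hci
    linarith [h₁.1, h₂.2]
  · intro ε hε c u hu0 hu t _ i
    have hw : ∀ τ, HasDerivAt (fun τ => ε⁻¹ • u (ε * τ)) ((G (ε⁻¹ • u (ε * τ)))⁻¹ • ξ) τ := by
      intro τ
      have hscale : HasDerivAt (fun τ : ℝ => ε * τ) ε τ := by
        simpa using (hasDerivAt_id τ).const_mul ε
      have hd := ((hu (ε * τ)).scomp τ hscale).const_smul ε⁻¹
      rw [inv_smul_smul₀ hε.ne'] at hd
      exact hd
    have hb := h _ hw (t / ε) i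
    simp only [mul_div_cancel₀ t hε.ne', mul_zero, hu0, Pi.smul_apply, smul_eq_mul] at hb
    have heq : u t i - (c i + fbar i * t)
        = ε * (ε⁻¹ * u t i - (ε⁻¹ * c i + fbar i * (t / ε))) := by
      field_simp
    rw [heq, abs_mul, abs_of_pos hε, mul_comm C]
    exact mul_le_mul_of_nonneg_left hb hε.le
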